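/- Let k ∈ ℕ and let f : ℝ^d × ℝ^d → ℂ be measurable with ‖f‖_{X_{k+1}} < ∞. Then ∫₀^∞ t^k ‖U₀(t)f‖_{X₀} dt ≤ ((2D)^{k+1}/(k+1)) · ‖f‖_{X_{k+1}}, i.e. ∫₀^∞ t^k ( ∫_{Ω×ℝ^d} |f(x − t·v, v)|·1_{{t < t₋(x,v)}} dx m(dv) ) dt ≤ ((2D)^{k+1}/(k+1)) ∫_{Ω×ℝ^d} max(1,|v|^{−(k+1)}) |f(x,v)| dx m(dv). -/

import Mathlib

open MeasureTheory Set Filter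
open scoped ENNReal NNReal Topology

/-- The backward exit time `t₋(x,v) = inf {s > 0 : x - s • v ∉ Ω}` (with `inf ∅ = ∞`),
valued in `ℝ≥0∞`. -/
noncomputable def tminus {d : ℕ} (Ω : Set (EuclideanSpace ℝ (Fin d)))
    (x v : EuclideanSpace ℝ (Fin d)) : ℝ≥0∞ :=
  ⨅ (s : ℝ) (_ : 0 < s ∧ x - s • v ∉ Ω), ENNReal.ofReal s

/-- The norm `‖f‖_{X_s} = ∫_{Ω×ℝ^d} max(1,|v|^{-s}) |f(x,v)| dx m(dv)`. -/
noncomputable def Xnorm {d : ℕ} (Ω : Set (EuclideanSpace ℝ (Fin d)))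
    (m : Measure (EuclideanSpace ℝ (Fin d))) (s : ℕ)
    (f : EuclideanSpace ℝ (Fin d) → EuclideanSpace ℝ (Fin d) → ℂ) : ℝ≥0∞ :=
  ∫⁻ x in Ω, ∫⁻ v, ENNReal.ofReal (max 1 (‖v‖⁻¹ ^ s)) * (‖f x v‖₊ : ℝ≥0∞) ∂m

/-- The free transport semigroup `(U₀(t)f)(x,v) = f(x - t v, v) 1_{t < t₋(x,v)}`. -/
noncomputable def freeTransport {d : ℕ} (Ω : Set (EuclideanSpace ℝ (Fin d)))
    (t : ℝ) (f : EuclideanSpace ℝ (Fin d) → EuclideanSpace ℝ (Fin d) → ℂ)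
    (x v : EuclideanSpace ℝ (Fin d)) : ℂ :=
  if ENNReal.ofReal t < tminus Ω x v then f (x - t • v) v else 0

/-- Before the exit time, the backward characteristic stays in `Ω`. -/
lemma sub_smul_mem_of_lt_tminus {d : ℕ} {Ω : Set (EuclideanSpace ℝ (Fin d))}
    {x v : EuclideanSpace ℝ (Fin d)} {t : ℝ} (ht : 0 < t)
    (h : ENNReal.ofReal t < tminus Ω x v) : x - t • v ∈ Ω := by
  by_contra hn
  exact absurd (iInf₂_le (f := fun (s : ℝ) (_ : 0 < s ∧ x - s • v ∉ Ω) => ENNReal.ofReal s)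
    t ⟨ht, hn⟩) (not_le.mpr h)

lemma enorm_freeTransport_le {d : ℕ} {Ω : Set (EuclideanSpace ℝ (Fin d))}
    (hΩ : Bornology.IsBounded Ω)
    (f : EuclideanSpace ℝ (Fin d) → EuclideanSpace ℝ (Fin d) → ℂ)
    {t : ℝ} (ht : 0 < t) {x : EuclideanSpace ℝ (Fin d)} (hx : x ∈ Ω)
    (v : EuclideanSpace ℝ (Fin d)) :
    (‖freeTransport Ω t f x v‖₊ : ℝ≥0∞) ≤
      {p : ℝ × EuclideanSpace ℝ (Fin d) | p.1 * ‖p.2‖ ≤ Metric.diam Ω}.indicator 1 (t, v) *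
        Ω.indicator (fun y => (‖f y v‖₊ : ℝ≥0∞)) (x - t • v) := by
  unfold freeTransport
  split_ifs with h
  · have hy := sub_smul_mem_of_lt_tminus ht h
    have hd : t * ‖v‖ ≤ Metric.diam Ω := by
      have := Metric.dist_le_diam_of_mem hΩ hx hy
      rwa [dist_eq_norm, sub_sub_cancel, norm_smul, Real.norm_of_nonneg ht.le] at this
    rw [indicator_of_mem (show (t, v) ∈ {p : ℝ × EuclideanSpace ℝ (Fin d) |
      p.1 * ‖p.2‖ ≤ Metric.diam Ω} from hd), indicator_of_mem hy]
    simp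
  · simp

lemma lintegral_Ioi_pow_mul_indicator_le (k : ℕ) {D r : ℝ} (hD : 0 ≤ D) (hr : 0 < r) :
    ∫⁻ t in Ioi (0 : ℝ), ENNReal.ofReal (t ^ k) * {t : ℝ | t * r ≤ D}.indicator 1 t
      ≤ ENNReal.ofReal (D ^ (k + 1) / (k + 1) * r⁻¹ ^ (k + 1)) := by
  have hDr : 0 ≤ D / r := by positivity
  have hset : {t : ℝ | t * r ≤ D} = Iic (D / r) := by
    ext t
    simp [le_div_iff₀ hr]
  have hind : ∀ t : ℝ, ENNReal.ofReal (t ^ k) * {t : ℝ | t * r ≤ D}.indicator 1 t =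
      (Iic (D / r)).indicator (fun t : ℝ => ENNReal.ofReal (t ^ k)) t := by
    intro t
    rw [hset]
    by_cases h : t ∈ Iic (D / r) <;> simp [h]
  simp_rw [hind]
  rw [lintegral_indicator measurableSet_Iic, Measure.restrict_restrict measurableSet_Iic,
    Iic_inter_Ioi, ← ofReal_integral_eq_lintegral_ofReal, ← intervalIntegral.integral_of_le hDr,
    integral_pow]
  · apply ENNReal.ofReal_le_ofReal
    rw [zero_pow (by omega), sub_zero, div_eq_mul_inv D r, mul_pow]
    exact le_of_eq (by ring)
  · exact (continuous_pow k).integrableOn_Ioc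
  · filter_upwards [ae_restrict_mem measurableSet_Ioc] with t ht
    exact pow_nonneg ht.1.le k

lemma Xnorm_zero_freeTransport_le {d : ℕ} {Ω : Set (EuclideanSpace ℝ (Fin d))}
    (hΩo : IsOpen Ω) (hΩ : Bornology.IsBounded Ω)
    (m : Measure (EuclideanSpace ℝ (Fin d))) [SigmaFinite m]
    {f : EuclideanSpace ℝ (Fin d) → EuclideanSpace ℝ (Fin d) → ℂ}
    (hf : Measurable (Function.uncurry f)) {t : ℝ} (ht : 0 < t) :
    Xnorm Ω m 0 (freeTransport Ω t f) ≤
      ∫⁻ v, {p : ℝ × EuclideanSpace ℝ (Fin d) | p.1 * ‖p.2‖ ≤ Metric.diam Ω}.indicator 1 (t, v) *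
        (∫⁻ y in Ω, (‖f y v‖₊ : ℝ≥0∞)) ∂m := by
  set S := {p : ℝ × EuclideanSpace ℝ (Fin d) | p.1 * ‖p.2‖ ≤ Metric.diam Ω}
  have hS : MeasurableSet S := measurableSet_le (by fun_prop) measurable_const
  have hg : Measurable fun p : EuclideanSpace ℝ (Fin d) × EuclideanSpace ℝ (Fin d) =>
      Ω.indicator (fun y => (‖f y p.2‖₊ : ℝ≥0∞)) p.1 :=
    (hf.nnnorm.coe_nnreal_ennreal).indicator (measurable_fst hΩo.measurableSet)
  have hT : Measurable fun p : EuclideanSpace ℝ (Fin d) × EuclideanSpace ℝ (Fin d) =>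
      (p.1 - t • p.2, p.2) := by fun_prop
  have hI : Measurable fun v : EuclideanSpace ℝ (Fin d) =>
      S.indicator (1 : ℝ × EuclideanSpace ℝ (Fin d) → ℝ≥0∞) (t, v) :=
    (measurable_one.indicator hS).comp measurable_prodMk_left
  calc Xnorm Ω m 0 (freeTransport Ω t f)
      ≤ ∫⁻ x in Ω, ∫⁻ v, S.indicator 1 (t, v) *
          Ω.indicator (fun y => (‖f y v‖₊ : ℝ≥0∞)) (x - t • v) ∂m := by
        refine setLIntegral_mono' hΩo.measurableSet fun x hx => lintegral_mono fun v => ?_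
        simpa using enorm_freeTransport_le hΩ f ht hx v
    _ ≤ ∫⁻ x, ∫⁻ v, S.indicator 1 (t, v) *
          Ω.indicator (fun y => (‖f y v‖₊ : ℝ≥0∞)) (x - t • v) ∂m := setLIntegral_le_lintegral _ _
    _ = ∫⁻ v, ∫⁻ x, S.indicator 1 (t, v) *
          Ω.indicator (fun y => (‖f y v‖₊ : ℝ≥0∞)) (x - t • v) ∂volume ∂m :=
        lintegral_lintegral_swap ((hI.comp measurable_snd).mul (hg.comp hT)).aemeasurable
    _ = _ := by
        refine lintegral_congr fun v => ?_
        rw [lintegral_const_mul _ (by exact (hg.comp hT).comp measurable_prodMk_right),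
          lintegral_sub_right_eq_self (fun x => Ω.indicator (fun y => (‖f y v‖₊ : ℝ≥0∞)) x),
          lintegral_indicator hΩo.measurableSet]

/-- Weighted time integrability of the free transport semigroup:
`∫₀^∞ t^k ‖U₀(t)f‖_{X₀} dt ≤ ((2D)^{k+1}/(k+1)) ‖f‖_{X_{k+1}}` for `f ∈ X_{k+1}`. -/
theorem freeTransport_weighted_time_integral {d : ℕ} (hd : 1 ≤ d)
    (Ω : Set (EuclideanSpace ℝ (Fin d))) (hΩopen : IsOpen Ω)
    (hΩne : Ω.Nonempty) (hΩbdd : Bornology.IsBounded Ω)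
    (m : Measure (EuclideanSpace ℝ (Fin d))) [SigmaFinite m] (hm0 : m {0} = 0)
    (k : ℕ)
    (f : EuclideanSpace ℝ (Fin d) → EuclideanSpace ℝ (Fin d) → ℂ)
    (hf : Measurable (Function.uncurry f))
    (hfX : Xnorm Ω m (k + 1) f < ⊤) :
    ∫⁻ t in Set.Ioi (0 : ℝ), ENNReal.ofReal (t ^ k) * Xnorm Ω m 0 (freeTransport Ω t f)
      ≤ ENNReal.ofReal ((2 * Metric.diam Ω) ^ (k + 1) / (k + 1)) * Xnorm Ω m (k + 1) f := by
  set S := {p : ℝ × EuclideanSpace ℝ (Fin d) | p.1 * ‖p.2‖ ≤ Metric.diam Ω}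
  have hS : MeasurableSet S := measurableSet_le (by fun_prop) measurable_const
  have hI : Measurable (S.indicator (1 : ℝ × EuclideanSpace ℝ (Fin d) → ℝ≥0∞)) :=
    measurable_one.indicator hS
  have hnf : Measurable fun p : EuclideanSpace ℝ (Fin d) × EuclideanSpace ℝ (Fin d) =>
      (‖f p.1 p.2‖₊ : ℝ≥0∞) := hf.nnnorm.coe_nnreal_ennreal
  have hG : Measurable fun v => ∫⁻ y in Ω, (‖f y v‖₊ : ℝ≥0∞) := hnf.lintegral_prod_left'
  have hw : Measurable fun v : EuclideanSpace ℝ (Fin d) =>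
      ENNReal.ofReal (max 1 (‖v‖⁻¹ ^ (k + 1))) := by fun_prop
  have hD : 0 ≤ Metric.diam Ω := Metric.diam_nonneg
  have hv0 : ∀ᵐ v ∂m, v ≠ 0 := by
    rw [ae_iff]
    simpa using hm0
  calc ∫⁻ t in Ioi (0 : ℝ), ENNReal.ofReal (t ^ k) * Xnorm Ω m 0 (freeTransport Ω t f)
      ≤ ∫⁻ t in Ioi (0 : ℝ), ∫⁻ v, ENNReal.ofReal (t ^ k) *
          (S.indicator 1 (t, v) * ∫⁻ y in Ω, (‖f y v‖₊ : ℝ≥0∞)) ∂m := by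
        refine setLIntegral_mono' measurableSet_Ioi fun t ht => ?_
        rw [lintegral_const_mul _ (by exact (hI.comp measurable_prodMk_left).mul hG)]
        gcongr
        exact Xnorm_zero_freeTransport_le hΩopen hΩbdd m hf ht
    _ = ∫⁻ v, (∫⁻ t in Ioi (0 : ℝ), ENNReal.ofReal (t ^ k) *
          (S.indicator 1 (t, v) * ∫⁻ y in Ω, (‖f y v‖₊ : ℝ≥0∞))) ∂m := by
        refine lintegral_lintegral_swap (Measurable.aemeasurable ?_)
        exact (ENNReal.measurable_ofReal.comp (measurable_fst.pow_const k)).mul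
          (hI.mul (hG.comp measurable_snd))
    _ ≤ ∫⁻ v, ENNReal.ofReal ((2 * Metric.diam Ω) ^ (k + 1) / (k + 1)) *
          (ENNReal.ofReal (max 1 (‖v‖⁻¹ ^ (k + 1))) * ∫⁻ y in Ω, (‖f y v‖₊ : ℝ≥0∞)) ∂m := by
        refine lintegral_mono_ae ?_
        filter_upwards [hv0] with v hv
        simp_rw [← mul_assoc]
        rw [lintegral_mul_const _ (by
          exact (ENNReal.measurable_ofReal.comp (measurable_id.pow_const k)).mul
            (hI.comp measurable_prodMk_right)), ← ENNReal.ofReal_mul (by positivity)]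
        gcongr
        refine (lintegral_Ioi_pow_mul_indicator_le k hD (norm_pos_iff.mpr hv)).trans
          (ENNReal.ofReal_le_ofReal ?_)
        gcongr
        · linarith
        · exact le_max_right _ _
    _ = ENNReal.ofReal ((2 * Metric.diam Ω) ^ (k + 1) / (k + 1)) * Xnorm Ω m (k + 1) f := by
        rw [lintegral_const_mul _ (by exact hw.mul hG), Xnorm, lintegral_lintegral_swap
          ((hw.comp measurable_snd).mul hnf).aemeasurable]
        congr 1
        refine lintegral_congr fun v => ?_
        rw [lintegral_const_mul _ (by exact hnf.comp measurable_prodMk_right)]
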